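/- Let X be a 3×3 real matrix with all entries positive and X_{ij}·X_{ji} = 1 for all i, j, and let g be the row geometric mean vector, g_i = (X_{i1}·X_{i2}·X_{i3})^{1/3}. Then g is simultaneously: (a) an eigenvector of X with all positive entries (hence, up to positive scaling, the Perron eigenvector of X), and (b) a max-times eigenvector of X, i.e., there exists μ > 0 with max_j X_{ij}·g_j = μ·g_i for every i. In particular, for n = 3 all three methods (Principal Eigenvector, HodgeRank, Tropical Eigenvector) produce the same score vector up to scaling. -/

import Mathlib

open Matrix

/-- A max-times eigenpair `(lam, v)` of a positive matrix X: lam > 0, v positive, and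
`max_j X i j * v j = lam * v i` for every row i. -/
def IsMaxTimesEigenpair {n : ℕ} (X : Matrix (Fin n) (Fin n) ℝ) (lam : ℝ)
    (v : Fin n → ℝ) : Prop :=
  0 < lam ∧ (∀ i, 0 < v i) ∧
    ∀ i, (∀ j, X i j * v j ≤ lam * v i) ∧ (∃ j, X i j * v j = lam * v i)

/-- The row geometric mean (HodgeRank) vector of a 3×3 positive matrix. -/
noncomputable def rowGeomMean3 (X : Matrix (Fin 3) (Fin 3) ℝ) : Fin 3 → ℝ :=
  fun i => (∏ j, X i j) ^ ((1 : ℝ) / 3)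

/-- The cube of an entry of the row geometric mean vector of a 3×3 matrix is the product of the
entries of the row. -/
lemma rowGeomMean3_pow_three {X : Matrix (Fin 3) (Fin 3) ℝ} (hpos : ∀ i j, 0 < X i j)
    (i : Fin 3) : rowGeomMean3 X i ^ 3 = X i 0 * X i 1 * X i 2 := by
  have h : 0 ≤ ∏ j, X i j := Finset.prod_nonneg fun j _ => (hpos i j).le
  rw [rowGeomMean3, ← Real.rpow_natCast, ← Real.rpow_mul h, Fin.prod_univ_three]
  norm_num

lemma rowGeomMean3_pos {X : Matrix (Fin 3) (Fin 3) ℝ} (hpos : ∀ i j, 0 < X i j) (i : Fin 3) :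
    0 < rowGeomMean3 X i :=
  Real.rpow_pos_of_pos (Finset.prod_pos fun j _ => hpos i j) _

/-- If `s` is the geometric mean of `X` along the cycle `i → j → k → i` of a 3×3 paired
comparison matrix, then `X i j` maps the `j`-th row geometric mean to `s` times the `i`-th. -/
lemma mul_rowGeomMean3_eq {X : Matrix (Fin 3) (Fin 3) ℝ} (hpos : ∀ i j, 0 < X i j)
    (hrec : ∀ i j, X i j * X j i = 1) {s : ℝ} (hs : 0 < s) {i j k : Fin 3}
    (hij : i ≠ j) (hjk : j ≠ k) (hki : k ≠ i) (h : s ^ 3 = X i j * X j k * X k i) :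
    X i j * rowGeomMean3 X j = s * rowGeomMean3 X i := by
  have hdiag : ∀ l, X l l = 1 := fun l => by nlinarith [hpos l l, hrec l l]
  have hrow : ∀ l m n : Fin 3, l ≠ m → m ≠ n → n ≠ l →
      rowGeomMean3 X l ^ 3 = X l m * X l n := by
    intro l m n hlm hmn hnl
    rw [rowGeomMean3_pow_three hpos]
    fin_cases l <;> fin_cases m <;> fin_cases n <;>
      first | contradiction | (simp [hdiag]; try ring)
  rw [← pow_left_inj₀ (mul_pos (hpos i j) (rowGeomMean3_pos hpos j)).le
    (mul_pos hs (rowGeomMean3_pos hpos i)).le three_ne_zero, mul_pow, mul_pow, h,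
    hrow i j k hij hjk hki, hrow j i k hij.symm hki.symm hjk.symm]
  linear_combination X i j ^ 2 * X j k * hrec i j - X i j ^ 2 * X j k * hrec k i

/-- for a 3×3 MPCM X (positive entries, X_{ij}·X_{ji} = 1), the row
geometric mean vector g is positive and is simultaneously an eigenvector of X
(hence up to scaling the Perron eigenvector) and a max-times (tropical)
eigenvector of X; so for n = 3 all three methods agree up to scaling. -/
theorem three_by_three_all_methods_agree (X : Matrix (Fin 3) (Fin 3) ℝ)
    (hpos : ∀ i j, 0 < X i j) (hrec : ∀ i j, X i j * X j i = 1) :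
    (∀ i, 0 < rowGeomMean3 X i) ∧
    (∃ ρ : ℝ, X.mulVec (rowGeomMean3 X) = ρ • rowGeomMean3 X) ∧
    (∃ mu : ℝ, IsMaxTimesEigenpair X mu (rowGeomMean3 X)) := by
  have hg := rowGeomMean3_pos hpos
  have hdiag : ∀ l, X l l = 1 := fun l => by nlinarith [hpos l l, hrec l l]
  have hc : 0 < X 0 1 * X 1 2 * X 2 0 := mul_pos (mul_pos (hpos 0 1) (hpos 1 2)) (hpos 2 0)
  obtain ⟨s, hs, hs3⟩ : ∃ s : ℝ, 0 < s ∧ s ^ 3 = X 0 1 * X 1 2 * X 2 0 :=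
    ⟨_, Real.rpow_pos_of_pos hc (1 / 3), by
      rw [← Real.rpow_natCast, ← Real.rpow_mul hc.le]; norm_num⟩
  have ht : 0 < s⁻¹ := inv_pos.mpr hs
  have ht3 : s⁻¹ ^ 3 = X 0 2 * X 2 1 * X 1 0 := by
    rw [inv_pow, hs3]
    refine inv_eq_of_mul_eq_one_right ?_
    linear_combination X 1 2 * X 2 0 * X 0 2 * X 2 1 * hrec 0 1
      + X 2 0 * X 0 2 * hrec 1 2 + hrec 2 0
  have h01 := mul_rowGeomMean3_eq (i := 0) (j := 1) (k := 2) hpos hrec hs (by decide) (by decide)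
    (by decide) hs3
  have h12 := mul_rowGeomMean3_eq (i := 1) (j := 2) (k := 0) hpos hrec hs (by decide) (by decide)
    (by decide) (by rw [hs3]; ring)
  have h20 := mul_rowGeomMean3_eq (i := 2) (j := 0) (k := 1) hpos hrec hs (by decide) (by decide)
    (by decide) (by rw [hs3]; ring)
  have h02 := mul_rowGeomMean3_eq (i := 0) (j := 2) (k := 1) hpos hrec ht (by decide) (by decide)
    (by decide) ht3
  have h21 := mul_rowGeomMean3_eq (i := 2) (j := 1) (k := 0) hpos hrec ht (by decide) (by decide)
    (by decide) (by rw [ht3]; ring)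
  have h10 := mul_rowGeomMean3_eq (i := 1) (j := 0) (k := 2) hpos hrec ht (by decide) (by decide)
    (by decide) (by rw [ht3]; ring)
  refine ⟨hg, ⟨1 + s + s⁻¹, ?_⟩, max s s⁻¹, lt_max_of_lt_left hs, hg, fun i => ⟨fun j => ?_, ?_⟩⟩
  · ext i
    fin_cases i <;>
      simp only [Matrix.mulVec, dotProduct, Fin.sum_univ_three, Pi.smul_apply, smul_eq_mul,
        Fin.zero_eta, Fin.mk_one, Fin.reduceFinMk, hdiag, h01, h02, h10, h12, h20, h21] <;> ring
  · have h1 : 1 ≤ max s s⁻¹ := by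
      rcases le_total 1 s with h | h
      · exact le_max_of_le_left h
      · exact le_max_of_le_right ((one_le_inv₀ hs).mpr h)
    fin_cases i <;> fin_cases j <;>
      simp only [Fin.zero_eta, Fin.mk_one, Fin.reduceFinMk, hdiag, h01, h02, h10, h12, h20, h21] <;>
      refine mul_le_mul_of_nonneg_right ?_ (hg _).le <;> simp [h1]
  · rcases max_choice s s⁻¹ with h | h <;> rw [h] <;> fin_cases i
    exacts [⟨1, h01⟩, ⟨2, h12⟩, ⟨0, h20⟩, ⟨2, h02⟩, ⟨0, h10⟩, ⟨1, h21⟩]
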